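/- arXiv:math/0703179 — 2 statements merged into one kernel-verified Lean document; each statement's English description precedes it below -/
import Mathlib

section
/- Let c < d, let μ, σ : ℝ → ℝ, α ≥ 0, and let ψ, φ : ℝ → ℝ be twice differentiable on (c,d) with φ(z) > 0 and ψ(z) > 0 for z ∈ (c,d), both satisfying the equation (1/2)σ(z)²·u''(z) + μ(z)·u'(z) − α·u(z) = 0 on (c,d). Set F = ψ/φ and assume F'(z) > 0 on (c,d) and σ(z) > 0 on (c,d), so that F is strictly increasing with inverse G on (F(c),F(d)). Let h : ℝ → ℝ be twice differentiable on (c,d), and let H : ℝ → ℝ satisfy H(F(z)) = h(z)/φ(z) for all z ∈ (c,d). Then for every x ∈ (c,d), H is twice differentiable at F(x) and H''(F(x)) = (2/(σ(x)²·φ(x)·F'(x)²)) · ((1/2)σ(x)²·h''(x) + μ(x)·h'(x) − α·h(x)). In particular, H''(F(x)) has the same sign as ((1/2)σ²h'' + μh' − αh)(x), and H''(F(x))·((1/2)σ²h'' + μh' − αh)(x) ≥ 0 with strict inequality whenever H''(F(x)) ≠ 0. -/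
open Set

open Filter Topology

/-- If `K ∘ F` agrees with `k` near `x` and `F` is strictly differentiable at `x` with nonzero
derivative, then `K` is differentiable at `F x`, with derivative the quotient of those of `k` and `F`. -/
theorem HasStrictDerivAt.hasDerivAt_of_comp_eventuallyEq {F K k : ℝ → ℝ} {F' k' x : ℝ}
    (hF : HasStrictDerivAt F F' x) (hF' : F' ≠ 0) (hk : HasDerivAt k k' x)
    (hK : ∀ᶠ z in 𝓝 x, K (F z) = k z) : HasDerivAt K (k' / F') (F x) := by
  set g := hF.localInverse F F' x hF' with hg_def
  have hg : HasDerivAt g F'⁻¹ (F x) := (hF.to_localInverse hF').hasDerivAt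
  have hmap : map F (𝓝 x) = 𝓝 (F x) := hF.map_nhds_eq hF'
  have hgF : ∀ᶠ z in 𝓝 x, g (F z) = z :=
    (hF.hasStrictFDerivAt_equiv hF').eventually_left_inverse
  have hgx : g (F x) = x := hgF.self_of_nhds
  have hKg : K =ᶠ[𝓝 (F x)] k ∘ g := by
    rw [← hmap]
    refine eventually_map.2 ?_
    filter_upwards [hgF, hK] with z hz hKz
    simp [hz, hKz]
  rw [← hgx] at hk
  rw [div_eq_mul_inv]
  exact (hk.comp (F x) hg).congr_of_eventuallyEq hKg

/-- Second identity of (4.1): with `ψ, φ` positive solutions of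
`(1/2)σ²u'' + μu' − αu = 0` on `(c,d)`, `F = ψ/φ` strictly increasing (with `F' > 0`)
and inverse `G`, and `H` satisfying `H (F z) = h z / φ z` on `(c,d)`, the function `H`
is twice differentiable at `F x` for `x ∈ (c,d)` and
`H''(F x) = (2/(σ x² φ x F' x²)) ((1/2)σ x² h'' x + μ x h' x − α h x)`; in particular
`H''(F x)` and `(A−α)h(x)` have the same sign. -/
theorem transformed_second_derivative (c d : ℝ) (hcd : c < d)
    (μ σ : ℝ → ℝ) (α : ℝ) (hα : 0 ≤ α)
    (ψ φ : ℝ → ℝ)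
    (hψdiff : ∀ z ∈ Set.Ioo c d, DifferentiableAt ℝ ψ z ∧ DifferentiableAt ℝ (deriv ψ) z)
    (hφdiff : ∀ z ∈ Set.Ioo c d, DifferentiableAt ℝ φ z ∧ DifferentiableAt ℝ (deriv φ) z)
    (hφpos : ∀ z ∈ Set.Ioo c d, 0 < φ z) (hψpos : ∀ z ∈ Set.Ioo c d, 0 < ψ z)
    (hψode : ∀ z ∈ Set.Ioo c d,
      (1/2) * σ z ^ 2 * deriv (deriv ψ) z + μ z * deriv ψ z - α * ψ z = 0)
    (hφode : ∀ z ∈ Set.Ioo c d,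
      (1/2) * σ z ^ 2 * deriv (deriv φ) z + μ z * deriv φ z - α * φ z = 0)
    (F : ℝ → ℝ) (hF : ∀ z, F z = ψ z / φ z)
    (hF'pos : ∀ z ∈ Set.Ioo c d, 0 < deriv F z)
    (hσpos : ∀ z ∈ Set.Ioo c d, 0 < σ z)
    (G : ℝ → ℝ)
    (hGmaps : ∀ y ∈ Set.Ioo (F c) (F d), G y ∈ Set.Ioo c d)
    (hGF : ∀ z ∈ Set.Ioo c d, G (F z) = z)
    (hFG : ∀ y ∈ Set.Ioo (F c) (F d), F (G y) = y)
    (h : ℝ → ℝ)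
    (hhdiff : ∀ z ∈ Set.Ioo c d, DifferentiableAt ℝ h z ∧ DifferentiableAt ℝ (deriv h) z)
    (H : ℝ → ℝ) (hH : ∀ z ∈ Set.Ioo c d, H (F z) = h z / φ z) :
    ∀ x ∈ Set.Ioo c d,
      (DifferentiableAt ℝ H (F x) ∧ DifferentiableAt ℝ (deriv H) (F x)) ∧
      deriv (deriv H) (F x)
        = (2 / (σ x ^ 2 * φ x * (deriv F x) ^ 2))
          * ((1/2) * σ x ^ 2 * deriv (deriv h) x + μ x * deriv h x - α * h x) ∧
      deriv (deriv H) (F x)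
        * ((1/2) * σ x ^ 2 * deriv (deriv h) x + μ x * deriv h x - α * h x) ≥ 0 ∧
      (deriv (deriv H) (F x) ≠ 0 →
        deriv (deriv H) (F x)
          * ((1/2) * σ x ^ 2 * deriv (deriv h) x + μ x * deriv h x - α * h x) > 0) := by
  intro x hx
  have hnhds : ∀ z ∈ Ioo c d, Ioo c d ∈ 𝓝 z := fun z hz => isOpen_Ioo.mem_nhds hz
  have hFderiv : ∀ z ∈ Ioo c d,
      HasDerivAt F ((deriv ψ z * φ z - ψ z * deriv φ z) / φ z ^ 2) z := by
    intro z hz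
    rw [show F = fun z => ψ z / φ z from funext hF]
    exact (hψdiff z hz).1.hasDerivAt.fun_div (hφdiff z hz).1.hasDerivAt (hφpos z hz).ne'
  have hWpos : ∀ z ∈ Ioo c d, 0 < deriv ψ z * φ z - ψ z * deriv φ z := by
    intro z hz
    have hpos := hF'pos z hz
    rw [(hFderiv z hz).deriv] at hpos
    exact (div_pos_iff_of_pos_right (pow_pos (hφpos z hz) 2)).1 hpos
  have hFstrict : ∀ z ∈ Ioo c d,
      HasStrictDerivAt F ((deriv ψ z * φ z - ψ z * deriv φ z) / φ z ^ 2) z := by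
    intro z hz
    refine hasStrictDerivAt_of_hasDerivAt_of_continuousAt
      (eventually_of_mem (hnhds z hz) hFderiv) ?_
    have h1 := (hψdiff z hz).1.continuousAt
    have h2 := (hψdiff z hz).2.continuousAt
    have h3 := (hφdiff z hz).1.continuousAt
    have h4 := (hφdiff z hz).2.continuousAt
    exact ((h2.mul h3).sub (h1.mul h4)).div (h3.pow 2) (pow_pos (hφpos z hz) 2).ne'
  have hFne : ∀ z ∈ Ioo c d, (deriv ψ z * φ z - ψ z * deriv φ z) / φ z ^ 2 ≠ 0 :=
    fun z hz => (div_pos (hWpos z hz) (pow_pos (hφpos z hz) 2)).ne'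
  have hHderiv : ∀ z ∈ Ioo c d, HasDerivAt H
      ((deriv h z * φ z - h z * deriv φ z) / φ z ^ 2 /
        ((deriv ψ z * φ z - ψ z * deriv φ z) / φ z ^ 2)) (F z) := fun z hz =>
    (hFstrict z hz).hasDerivAt_of_comp_eventuallyEq (hFne z hz)
      ((hhdiff z hz).1.hasDerivAt.fun_div (hφdiff z hz).1.hasDerivAt (hφpos z hz).ne')
      (eventually_of_mem (hnhds z hz) hH)
  have hHfirst : ∀ z ∈ Ioo c d, deriv H (F z) =
      (deriv h z * φ z - h z * deriv φ z) / (deriv ψ z * φ z - ψ z * deriv φ z) := by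
    intro z hz
    rw [(hHderiv z hz).deriv, div_div_div_cancel_right₀ (pow_pos (hφpos z hz) 2).ne']
  have hwronskian : ∀ u : ℝ → ℝ, DifferentiableAt ℝ u x ∧ DifferentiableAt ℝ (deriv u) x →
      HasDerivAt (fun z => deriv u z * φ z - u z * deriv φ z)
        (deriv (deriv u) x * φ x - u x * deriv (deriv φ) x) x := by
    intro u hu
    have h1 := (hu.2.hasDerivAt.fun_mul (hφdiff x hx).1.hasDerivAt).fun_sub
      (hu.1.hasDerivAt.fun_mul (hφdiff x hx).2.hasDerivAt)
    exact h1.congr_deriv (by ring)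
  have hHsecond := (hFstrict x hx).hasDerivAt_of_comp_eventuallyEq (hFne x hx)
    ((hwronskian h (hhdiff x hx)).fun_div (hwronskian ψ (hψdiff x hx)) (hWpos x hx).ne')
    (eventually_of_mem (hnhds x hx) hHfirst)
  have hφx := hφpos x hx
  have hσx := hσpos x hx
  have hFx := hF'pos x hx
  have hformula : deriv (deriv H) (F x)
      = (2 / (σ x ^ 2 * φ x * (deriv F x) ^ 2))
        * ((1/2) * σ x ^ 2 * deriv (deriv h) x + μ x * deriv h x - α * h x) := by
    have hW := (hWpos x hx).ne'
    have hφsecond : deriv (deriv φ) x = 2 * (α * φ x - μ x * deriv φ x) / σ x ^ 2 := by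
      rw [eq_div_iff (pow_pos hσx 2).ne']
      linear_combination 2 * hφode x hx
    have hW' : deriv (deriv ψ) x * φ x - ψ x * deriv (deriv φ) x
        = -2 * μ x * (deriv ψ x * φ x - ψ x * deriv φ x) / σ x ^ 2 := by
      rw [eq_div_iff (pow_pos hσx 2).ne']
      linear_combination 2 * φ x * hψode x hx - 2 * ψ x * hφode x hx
    rw [hHsecond.deriv, (hFderiv x hx).deriv, hW', hφsecond]
    generalize deriv ψ x * φ x - ψ x * deriv φ x = w at hW
    field_simp
    ring
  have hcoef : 0 < 2 / (σ x ^ 2 * φ x * (deriv F x) ^ 2) := by positivity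
  refine ⟨⟨(hHderiv x hx).differentiableAt, hHsecond.differentiableAt⟩, hformula, ?_, ?_⟩
  · rw [hformula, mul_assoc]
    exact mul_nonneg hcoef.le (mul_self_nonneg _)
  · intro hne
    rw [hformula] at hne ⊢
    rw [mul_assoc]
    exact mul_pos hcoef (mul_self_pos.2 (right_ne_zero_of_mul hne))
end

section
/- Let c > 0, λ ≥ 0, a > 0 and α > 0, define H : (0,∞) → ℝ by H(y) = √y · ( −c − (λ/(2√(2α)))·log y + λ·a + (log y)²/(8α²) − a²/α ), and set k = (λα + √((λα − 2a)² + 4αc + 4/α))/2. Then H is concave on the interval [e^{2k√(2α)}, ∞). -/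
open Set Real

lemma hasDerivAt_sqrt_mul_quadratic_log (A B C : ℝ) {y : ℝ} (hy : 0 < y) :
    HasDerivAt (fun y => √y * (A + B * log y + C * log y ^ 2))
      (((A / 2 + B) + (B / 2 + 2 * C) * log y + C / 2 * log y ^ 2) / √y) y := by
  have hlog := hasDerivAt_log hy.ne'
  have hq := ((hlog.const_mul B).const_add A).add ((hlog.pow 2).const_mul C)
  refine ((hasDerivAt_sqrt hy.ne').mul hq).congr_deriv ?_
  obtain ⟨s, hs, rfl⟩ : ∃ s, 0 < s ∧ y = s ^ 2 := ⟨√y, sqrt_pos.2 hy, (sq_sqrt hy.le).symm⟩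
  simp only [sqrt_sq hs.le, Pi.add_apply, Pi.pow_apply]
  field_simp
  ring

lemma hasDerivAt_quadratic_log_div_sqrt (A B C : ℝ) {y : ℝ} (hy : 0 < y) :
    HasDerivAt (fun y => (A + B * log y + C * log y ^ 2) / √y)
      (((B - A / 2) + (2 * C - B / 2) * log y - C / 2 * log y ^ 2) / (y * √y)) y := by
  have hlog := hasDerivAt_log hy.ne'
  have hq := ((hlog.const_mul B).const_add A).add ((hlog.pow 2).const_mul C)
  refine (hq.div (hasDerivAt_sqrt hy.ne') (sqrt_pos.2 hy).ne').congr_deriv ?_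
  obtain ⟨s, hs, rfl⟩ : ∃ s, 0 < s ∧ y = s ^ 2 := ⟨√y, sqrt_pos.2 hy, (sq_sqrt hy.le).symm⟩
  simp only [sqrt_sq hs.le, Pi.add_apply, Pi.pow_apply]
  field_simp
  ring

/-- The sign condition is that of `q'' - q / 4`, where `q t = A + B * t + C * t ^ 2`. -/
lemma concaveOn_sqrt_mul_quadratic_log (A B C t₀ : ℝ)
    (h : ∀ t, t₀ < t → 2 * C - (A + B * t + C * t ^ 2) / 4 ≤ 0) :
    ConcaveOn ℝ (Ici (exp t₀)) (fun y => √y * (A + B * log y + C * log y ^ 2)) := by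
  have hpos : ∀ y ∈ Ici (exp t₀), 0 < y := fun y hy => (exp_pos t₀).trans_le hy
  refine concaveOn_of_hasDerivWithinAt2_nonpos (convex_Ici _)
    (fun y hy =>
      (hasDerivAt_sqrt_mul_quadratic_log A B C (hpos y hy)).continuousAt.continuousWithinAt)
    (fun y hy =>
      (hasDerivAt_sqrt_mul_quadratic_log A B C (hpos y (interior_subset hy))).hasDerivWithinAt)
    (fun y hy =>
      (hasDerivAt_quadratic_log_div_sqrt _ _ _ (hpos y (interior_subset hy))).hasDerivWithinAt)
    (fun y hy => ?_)
  have hy0 := hpos y (interior_subset hy)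
  rw [interior_Ici] at hy
  have := h (log y) ((lt_log_iff_exp_lt hy0).2 hy)
  refine div_nonpos_of_nonpos_of_nonneg ?_ (by positivity)
  linarith

lemma quadratic_nonpos_of_largest_root_le {b d x : ℝ} (h : (b + √(b ^ 2 + 4 * d)) / 2 ≤ x) :
    -x ^ 2 + b * x + d ≤ 0 := by
  have := (sqrt_le_iff (x := b ^ 2 + 4 * d) (y := 2 * x - b)).1 (by linarith)
  nlinarith [this.2]

/-- With `H y = √y (−c − (λ/(2√(2α))) log y + λa + (log y)²/(8α²) − a²/α)`
and `k` the largest root of the quadratic `p(x) = −x² + a² + λα(x−a) + αc + 1/α`, `H` is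
concave on `[e^{2k√(2α)}, ∞)`. -/
theorem transformed_reward_concave_beyond_root (c lam a α : ℝ)
    (hc : 0 < c) (hlam : 0 ≤ lam) (ha : 0 < a) (hα : 0 < α)
    (H : ℝ → ℝ)
    (hH : ∀ y : ℝ, 0 < y →
      H y = Real.sqrt y * (-c - (lam / (2 * Real.sqrt (2 * α))) * Real.log y
        + lam * a + (Real.log y) ^ 2 / (8 * α ^ 2) - a ^ 2 / α))
    (k : ℝ)
    (hk : k = (lam * α + Real.sqrt ((lam * α - 2 * a) ^ 2 + 4 * α * c + 4 / α)) / 2) :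
    ConcaveOn ℝ (Set.Ici (Real.exp (2 * k * Real.sqrt (2 * α)))) H := by
  have hs : 0 < √(2 * α) := by positivity
  have hs2 : √(2 * α) ^ 2 = 2 * α := sq_sqrt (by positivity)
  refine (concaveOn_sqrt_mul_quadratic_log (-c + lam * a - a ^ 2 / α)
    (-(lam / (2 * √(2 * α)))) (1 / (8 * α ^ 2)) _ fun t ht => ?_).congr fun y hy => ?_
  · obtain ⟨x, rfl⟩ : ∃ x, t = 2 * x * √(2 * α) := ⟨t / (2 * √(2 * α)), by field_simp⟩
    have hx : k ≤ x := by
      have := lt_of_mul_lt_mul_right ht hs.le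
      linarith
    have hdisc : (lam * α - 2 * a) ^ 2 + 4 * α * c + 4 / α
        = (lam * α) ^ 2 + 4 * (a ^ 2 - lam * α * a + α * c + 1 / α) := by ring
    rw [hk, hdisc] at hx
    have hp := quadratic_nonpos_of_largest_root_le hx
    have hlin : -(lam / (2 * √(2 * α))) * (2 * x * √(2 * α)) = -(lam * x) := by field_simp
    have hsq : 1 / (8 * α ^ 2) * (2 * x * √(2 * α)) ^ 2 = x ^ 2 / α := by
      rw [mul_pow, hs2]
      field_simp
      ring
    rw [hlin, hsq]
    refine le_of_eq_of_le ?_ (div_nonpos_of_nonpos_of_nonneg hp (by positivity : 0 ≤ 4 * α))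
    field_simp
    ring
  · rw [hH y ((exp_pos _).trans_le hy)]
    ring
end
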